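/- Let (μ_N) be a sequence of probability measures on ℝ such that for every natural number k and every N ≥ 1, ∫ x^k dμ_N(x) = ⟨e_N, ((a + a†)/√(2N))^k e_N⟩. Then μ_N converges weakly to the normalized arcsine law μ_As as N → ∞. -/

import Mathlib

open MeasureTheory Filter

noncomputable def e (n : ℕ) : ℕ →₀ ℝ := Finsupp.single n 1

noncomputable def innerF (f g : ℕ →₀ ℝ) : ℝ := f.sum fun n c => c * g n

noncomputable def ann : (ℕ →₀ ℝ) →ₗ[ℝ] (ℕ →₀ ℝ) :=
  Finsupp.lsum ℝ fun n => Real.sqrt n • (Finsupp.lsingle (n - 1) : ℝ →ₗ[ℝ] (ℕ →₀ ℝ))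

noncomputable def cre : (ℕ →₀ ℝ) →ₗ[ℝ] (ℕ →₀ ℝ) :=
  Finsupp.lsum ℝ fun n => Real.sqrt (n + 1) • (Finsupp.lsingle (n + 1) : ℝ →ₗ[ℝ] (ℕ →₀ ℝ))


/-- The normalized arcsine law: the measure on `ℝ` with density
`x ↦ 1/(π·√(2 − x²))` on `(−√2, √2)` with respect to Lebesgue measure. -/
noncomputable def arcsineLaw : Measure ℝ :=
  (volume.restrict (Set.Ioo (-Real.sqrt 2) (Real.sqrt 2))).withDensity
    fun x => ENNReal.ofReal (1 / (Real.pi * Real.sqrt (2 - x ^ 2)))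

/-! ### Convergence of moments to a compactly supported law -/

theorem eventually_integrable_polynomial {μ : ℕ → Measure ℝ}
    (hint : ∀ k : ℕ, ∀ᶠ N in atTop, Integrable (fun x : ℝ => x ^ k) (μ N))
    (p : Polynomial ℝ) :
    ∀ᶠ N in atTop, Integrable (fun x => p.eval x) (μ N) := by
  have h : ∀ᶠ N in atTop, ∀ k ∈ Finset.range (p.natDegree + 1),
      Integrable (fun x : ℝ => x ^ k) (μ N) :=
    (Finset.eventually_all _).2 fun k _ => hint k
  filter_upwards [h] with N hN
  simp only [Polynomial.eval_eq_sum_range]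
  exact integrable_finsetSum _ fun k hk => (hN k hk).const_mul _

theorem tendsto_integral_polynomial {μ : ℕ → Measure ℝ} {ν : Measure ℝ}
    (hint : ∀ k : ℕ, ∀ᶠ N in atTop, Integrable (fun x : ℝ => x ^ k) (μ N))
    (hintν : ∀ k : ℕ, Integrable (fun x : ℝ => x ^ k) ν)
    (hmom : ∀ k : ℕ, Tendsto (fun N => ∫ x, x ^ k ∂(μ N)) atTop (nhds (∫ x, x ^ k ∂ν)))
    (p : Polynomial ℝ) :
    Tendsto (fun N => ∫ x, p.eval x ∂(μ N)) atTop (nhds (∫ x, p.eval x ∂ν)) := by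
  have h : ∀ᶠ N in atTop, ∀ k ∈ Finset.range (p.natDegree + 1),
      Integrable (fun x : ℝ => x ^ k) (μ N) :=
    (Finset.eventually_all _).2 fun k _ => hint k
  simp only [Polynomial.eval_eq_sum_range]
  rw [integral_finsetSum _ fun k _ => (hintν k).const_mul _]
  simp only [integral_const_mul]
  refine (tendsto_finsetSum _ fun k _ => (hmom k).const_mul (p.coeff k)).congr' ?_
  filter_upwards [h] with N hN
  rw [integral_finsetSum _ fun k hk => (hN k hk).const_mul _]
  simp only [integral_const_mul]

theorem exists_abs_sub_eval_le (f : BoundedContinuousFunction ℝ ℝ) {R ε : ℝ} (hR : 0 < R)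
    (hε : 0 < ε) :
    ∃ (p : Polynomial ℝ) (C : ℝ), 0 ≤ C ∧ ∀ n, p.natDegree ≤ n → ∀ x,
      |f x - p.eval x| ≤ ε + C * (x / R) ^ (2 * n) := by
  obtain ⟨p, hp⟩ := exists_polynomial_near_of_continuousOn (-R) R f f.continuous.continuousOn ε hε
  have hC : 0 ≤ ∑ i ∈ Finset.range (p.natDegree + 1), |p.coeff i| * R ^ i := by positivity
  refine ⟨p, ‖f‖ + ∑ i ∈ Finset.range (p.natDegree + 1), |p.coeff i| * R ^ i,
    by positivity, fun n hn x => ?_⟩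
  have hpow : 0 ≤ (x / R) ^ (2 * n) := by rw [pow_mul]; positivity
  by_cases hx : x ∈ Set.Icc (-R) R
  · have := hp x hx
    rw [abs_sub_comm] at this
    have h0 : 0 ≤ (‖f‖ + ∑ i ∈ Finset.range (p.natDegree + 1), |p.coeff i| * R ^ i) *
      (x / R) ^ (2 * n) := by positivity
    linarith
  · have hxR : 1 ≤ |x / R| := by
      rw [abs_div, abs_of_pos hR, one_le_div hR]
      by_contra! h
      exact hx (abs_le.1 h.le)
    have habs : (x / R) ^ (2 * n) = |x / R| ^ (2 * n) := by
      rw [pow_mul, pow_mul, sq_abs]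
    have hf : |f x| ≤ ‖f‖ * (x / R) ^ (2 * n) := by
      rw [habs]
      exact (f.norm_coe_le_norm x).trans
        (le_mul_of_one_le_right (norm_nonneg _) (one_le_pow₀ hxR))
    have hpx : |p.eval x| ≤
        (∑ i ∈ Finset.range (p.natDegree + 1), |p.coeff i| * R ^ i) * (x / R) ^ (2 * n) := by
      rw [Polynomial.eval_eq_sum_range, Finset.sum_mul]
      refine (Finset.abs_sum_le_sum_abs _ _).trans (Finset.sum_le_sum fun i hi => ?_)
      have hi' : i ≤ 2 * n := by
        have := Finset.mem_range.1 hi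
        omega
      have hxi : |x| ^ i = R ^ i * |x / R| ^ i := by
        rw [abs_div, abs_of_pos hR, ← mul_pow, mul_div_cancel₀ _ hR.ne']
      rw [abs_mul, abs_pow, hxi, habs, ← mul_assoc]
      gcongr
    have := abs_sub (f x) (p.eval x)
    rw [add_mul]
    linarith

theorem integrable_pow_of_ae_abs_le {ν : Measure ℝ} [IsFiniteMeasure ν] {r : ℝ}
    (hν : ∀ᵐ x ∂ν, |x| ≤ r) (k : ℕ) : Integrable (fun x : ℝ => x ^ k) ν := by
  refine Integrable.of_bound (by fun_prop) (r ^ k) ?_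
  filter_upwards [hν] with x hx
  rw [norm_pow, Real.norm_eq_abs]
  gcongr

theorem tendsto_integral_of_tendsto_moments {μ : ℕ → Measure ℝ} {ν : Measure ℝ}
    [∀ N, IsProbabilityMeasure (μ N)] [IsProbabilityMeasure ν] {r : ℝ} (hr : 0 < r)
    (hν : ∀ᵐ x ∂ν, |x| ≤ r)
    (hint : ∀ k : ℕ, ∀ᶠ N in atTop, Integrable (fun x : ℝ => x ^ k) (μ N))
    (hmom : ∀ k : ℕ, Tendsto (fun N => ∫ x, x ^ k ∂(μ N)) atTop (nhds (∫ x, x ^ k ∂ν)))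
    (f : BoundedContinuousFunction ℝ ℝ) :
    Tendsto (fun N => ∫ x, f x ∂(μ N)) atTop (nhds (∫ x, f x ∂ν)) := by
  have hintν := integrable_pow_of_ae_abs_le hν
  rw [Metric.tendsto_atTop']
  suffices h : ∀ ε > 0, ∀ᶠ N in atTop,
      |∫ x, f x ∂(μ N) - ∫ x, f x ∂ν| < 6 * ε by
    intro ε hε
    obtain ⟨n, hn⟩ := eventually_atTop.1 (h (ε / 6) (by positivity))
    refine ⟨n, fun N hN => ?_⟩
    have := hn N hN.le
    rwa [mul_div_cancel₀ _ (by norm_num)] at this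
  intro ε hε
  have hR : 0 < 2 * r := by positivity
  obtain ⟨p, C, hC, hpC⟩ := exists_abs_sub_eval_le f hR hε
  obtain ⟨n, hn, hnC⟩ : ∃ n, p.natDegree ≤ n ∧ C * (1 / 4) ^ n < ε := by
    have : Tendsto (fun n : ℕ => C * (1 / 4 : ℝ) ^ n) atTop (nhds (C * 0)) :=
      (tendsto_pow_atTop_nhds_zero_of_lt_one (by norm_num) (by norm_num)).const_mul C
    rw [mul_zero] at this
    exact ((eventually_ge_atTop p.natDegree).and (this.eventually_lt_const hε)).exists
  let q : Polynomial ℝ := Polynomial.C ε + Polynomial.C (C / (2 * r) ^ (2 * n)) *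
    Polynomial.X ^ (2 * n)
  have hq : ∀ x, |f x - p.eval x| ≤ q.eval x := fun x => by
    have h := hpC n hn x
    rw [div_pow] at h
    simp only [q, Polynomial.eval_add, Polynomial.eval_mul, Polynomial.eval_C, Polynomial.eval_pow,
      Polynomial.eval_X]
    convert h using 2
    ring
  have hqν : ∫ x, q.eval x ∂ν < 2 * ε := by
    have hle : ∀ᵐ x ∂ν, q.eval x ≤ ε + C * (1 / 4) ^ n := by
      filter_upwards [hν] with x hx
      simp only [q, Polynomial.eval_add, Polynomial.eval_mul, Polynomial.eval_C,
        Polynomial.eval_pow, Polynomial.eval_X]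
      have hx2 : x ^ 2 ≤ r ^ 2 := sq_le_sq' (abs_le.1 hx).1 (abs_le.1 hx).2
      have : x ^ (2 * n) ≤ (r ^ 2) ^ n := by rw [pow_mul]; gcongr
      calc ε + C / (2 * r) ^ (2 * n) * x ^ (2 * n)
          ≤ ε + C / (2 * r) ^ (2 * n) * (r ^ 2) ^ n := by gcongr
        _ = ε + C * (1 / 4) ^ n := by
          rw [pow_mul, mul_pow, mul_pow, div_pow, one_pow]
          field_simp
          norm_num
          ring
    have := integral_mono_of_nonneg (μ := ν)
      (Eventually.of_forall fun x => (abs_nonneg _).trans (hq x)) (integrable_const _) hle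
    rw [integral_const, probReal_univ, one_smul] at this
    linarith
  have hsub : ∀ (ρ : Measure ℝ) [IsProbabilityMeasure ρ], Integrable (fun x => p.eval x) ρ →
      Integrable (fun x => q.eval x) ρ →
      |∫ x, f x ∂ρ - ∫ x, p.eval x ∂ρ| ≤ ∫ x, q.eval x ∂ρ := fun ρ _ hp hq' => by
    rw [← integral_sub (f.integrable ρ) hp]
    exact (abs_integral_le_integral_abs).trans
      (integral_mono ((f.integrable ρ).sub hp).abs hq' hq)
  have hν' := hsub ν (eventually_integrable_polynomial (μ := fun _ => ν)
      (fun k => Eventually.of_forall fun _ => hintν k) p).exists.choose_spec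
    (eventually_integrable_polynomial (μ := fun _ => ν)
      (fun k => Eventually.of_forall fun _ => hintν k) q).exists.choose_spec
  filter_upwards [eventually_integrable_polynomial hint p,
    eventually_integrable_polynomial hint q,
    (tendsto_integral_polynomial hint hintν hmom q).eventually_lt_const hqν,
    Metric.tendsto_nhds.1 (tendsto_integral_polynomial hint hintν hmom p) ε hε] with N h1 h2 h3 h4
  have h5 := hsub (μ N) h1 h2
  rw [Real.dist_eq] at h4
  rw [abs_le] at h5 hν'
  rw [abs_lt] at h4 ⊢
  constructor <;> linarith [h5.1, h5.2, hν'.1, hν'.2, h4.1, h4.2]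

/-! ### The arcsine law as the image of the uniform law under `θ ↦ √2 cos θ` -/

theorem image_sqrt_two_mul_cos :
    (fun θ => √2 * Real.cos θ) '' Set.Ioo 0 Real.pi = Set.Ioo (-√2) √2 := by
  have h2 : (0 : ℝ) < √2 := by positivity
  ext x
  constructor
  · rintro ⟨θ, hθ, rfl⟩
    have h := Real.bijOn_cos.mapsTo (Set.Ioo_subset_Icc_self hθ)
    have hs := Real.sin_pos_of_mem_Ioo hθ
    have hsc := Real.sin_sq_add_cos_sq θ
    have h1 : Real.cos θ < 1 := lt_of_le_of_ne h.2 fun h => by rw [h] at hsc; nlinarith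
    have h3 : -1 < Real.cos θ := lt_of_le_of_ne h.1 fun h => by rw [← h] at hsc; nlinarith
    constructor <;> dsimp only <;> nlinarith
  · rintro ⟨h1, h3⟩
    have h1' : -1 < x / √2 := by rw [lt_div_iff₀ h2]; linarith
    have h3' : x / √2 < 1 := by rw [div_lt_iff₀ h2]; linarith
    refine ⟨Real.arccos (x / √2), ⟨Real.arccos_pos.2 h3', ?_⟩, ?_⟩
    · refine lt_of_le_of_ne (Real.arccos_le_pi _) fun h => ?_
      rw [Real.arccos_eq_pi] at h
      linarith
    · dsimp only
      rw [Real.cos_arccos h1'.le h3'.le, mul_div_cancel₀ _ h2.ne']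

theorem integral_arcsineLaw (g : ℝ → ℝ) :
    ∫ x, g x ∂arcsineLaw = ∫ θ in (0 : ℝ)..Real.pi, Real.pi⁻¹ * g (√2 * Real.cos θ) := by
  have h2 : (0 : ℝ) < √2 := by positivity
  have hinj : Set.InjOn (fun θ => √2 * Real.cos θ) (Set.Ioo 0 Real.pi) := fun a ha b hb hab =>
    Real.injOn_cos (Set.Ioo_subset_Icc_self ha) (Set.Ioo_subset_Icc_self hb)
      (mul_left_cancel₀ h2.ne' hab)
  have hderiv : ∀ θ ∈ Set.Ioo 0 Real.pi,
      HasDerivWithinAt (fun θ => √2 * Real.cos θ) (√2 * -Real.sin θ) (Set.Ioo 0 Real.pi) θ :=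
    fun θ _ => ((Real.hasDerivAt_cos θ).const_mul _).hasDerivWithinAt
  rw [arcsineLaw, integral_withDensity_eq_integral_toReal_smul (by fun_prop)
    (Eventually.of_forall fun _ => ENNReal.ofReal_lt_top), ← image_sqrt_two_mul_cos,
    integral_image_eq_integral_abs_deriv_smul measurableSet_Ioo hderiv hinj,
    intervalIntegral.integral_of_le Real.pi_pos.le, integral_Ioc_eq_integral_Ioo]
  refine setIntegral_congr_fun measurableSet_Ioo fun θ hθ => ?_
  have hs := Real.sin_pos_of_mem_Ioo hθ
  have hsq : √(2 - (√2 * Real.cos θ) ^ 2) = √2 * Real.sin θ := by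
    rw [Real.sqrt_eq_iff_mul_self_eq_of_pos (by positivity)]
    have := Real.sin_sq_add_cos_sq θ
    have h4 : √2 ^ 2 = (2 : ℝ) := Real.sq_sqrt (by norm_num)
    linear_combination (Real.sin θ ^ 2 + Real.cos θ ^ 2) * h4 + 2 * this
  have habs : |√2 * -Real.sin θ| = √2 * Real.sin θ := by
    rw [mul_neg, abs_neg, abs_of_pos (by positivity)]
  rw [hsq, habs, ENNReal.toReal_ofReal (by positivity), smul_eq_mul, smul_eq_mul]
  field_simp

instance isProbabilityMeasure_arcsineLaw : IsProbabilityMeasure arcsineLaw := by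
  have h := integral_arcsineLaw fun _ => 1
  rw [integral_const, intervalIntegral.integral_const] at h
  have h1 : arcsineLaw.real Set.univ = 1 := by
    simpa [Real.pi_ne_zero] using h
  refine ⟨?_⟩
  rw [measureReal_def] at h1
  exact (ENNReal.toReal_eq_one_iff _).1 h1

theorem ae_abs_le_arcsineLaw : ∀ᵐ x ∂arcsineLaw, |x| ≤ √2 := by
  refine (withDensity_absolutelyContinuous _ _).ae_le ?_
  filter_upwards [ae_restrict_mem measurableSet_Ioo] with x hx
  exact abs_le.2 ⟨hx.1.le, hx.2.le⟩

theorem integral_pow_even_arcsineLaw_pos (k : ℕ) : 0 < ∫ x, x ^ (2 * k) ∂arcsineLaw := by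
  rw [integral_arcsineLaw]
  refine intervalIntegral.integral_pos Real.pi_pos (by fun_prop) (fun θ _ => ?_)
    ⟨0, ⟨le_rfl, Real.pi_pos.le⟩, ?_⟩
  · rw [pow_mul]
    positivity
  · rw [Real.cos_zero]
    positivity

/-- The `j`-th Chebyshev coefficient of the `k`-th power for the arcsine law. -/
noncomputable def arcsineCoeff (k : ℕ) (j : ℤ) : ℝ :=
  ∫ θ in (0 : ℝ)..Real.pi, Real.pi⁻¹ * ((√2 * Real.cos θ) ^ k * Real.cos (j * θ))

theorem arcsineCoeff_zero_right (k : ℕ) : arcsineCoeff k 0 = ∫ x, x ^ k ∂arcsineLaw := by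
  simp [arcsineCoeff, integral_arcsineLaw]

theorem arcsineCoeff_zero_left (j : ℤ) : arcsineCoeff 0 j = if j = 0 then 1 else 0 := by
  split_ifs with hj
  · simp [arcsineCoeff, hj, Real.pi_ne_zero]
  · have hj' : (j : ℝ) ≠ 0 := by exact_mod_cast hj
    simp [arcsineCoeff, intervalIntegral.integral_comp_mul_left _ hj', Real.sin_int_mul_pi]

theorem arcsineCoeff_succ (k : ℕ) (j : ℤ) :
    arcsineCoeff (k + 1) j =
      (√2)⁻¹ * arcsineCoeff k (j + 1) + (√2)⁻¹ * arcsineCoeff k (j - 1) := by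
  simp only [arcsineCoeff, ← intervalIntegral.integral_const_mul]
  rw [← intervalIntegral.integral_add (Continuous.intervalIntegrable (by fun_prop) _ _)
    (Continuous.intervalIntegrable (by fun_prop) _ _)]
  refine intervalIntegral.integral_congr fun θ _ => ?_
  push_cast
  have h4 : √2 * √2 = (2 : ℝ) := Real.mul_self_sqrt (by norm_num)
  rw [add_mul, sub_mul, one_mul, Real.cos_add, Real.cos_sub, pow_succ]
  field_simp
  linear_combination (√2 * Real.cos θ) ^ k * Real.cos θ * Real.cos (j * θ) * h4

/-! ### Asymptotics of the matrix elements of the rescaled position operator -/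

theorem ann_apply (v : ℕ →₀ ℝ) (n : ℕ) : ann v n = √(n + 1) * v (n + 1) := by
  induction v using Finsupp.induction_linear with
  | zero => simp
  | add f g hf hg => simp [hf, hg, mul_add]
  | single m c =>
    rcases m with _ | m
    · simp [ann]
    · by_cases h : m = n
      · simp [ann, h]
      · simp [ann, h]

theorem cre_apply_succ (v : ℕ →₀ ℝ) (n : ℕ) : cre v (n + 1) = √(n + 1) * v n := by
  induction v using Finsupp.induction_linear with
  | zero => simp
  | add f g hf hg => simp [hf, hg, mul_add]
  | single m c =>
    by_cases h : m = n
    · simp [cre, h]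
    · simp [cre, h]

theorem innerF_e (n : ℕ) (g : ℕ →₀ ℝ) : innerF (e n) g = g n := by
  simp [innerF, e]

theorem tendsto_inv_sqrt_mul_sqrt (a : ℝ) :
    Tendsto (fun N : ℕ => (√(2 * N))⁻¹ * √(N + a)) atTop (nhds (√2)⁻¹) := by
  have h : Tendsto (fun N : ℕ => √(2⁻¹ * (1 + a / N))) atTop (nhds √(2⁻¹ * (1 + 0))) :=
    (((tendsto_const_div_atTop_nhds_zero_nat a).const_add 1).const_mul _).sqrt
  rw [add_zero, mul_one, Real.sqrt_inv] at h
  refine h.congr' ?_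
  filter_upwards [eventually_gt_atTop 0] with N hN
  have hN' : (0 : ℝ) < N := by exact_mod_cast hN
  rw [← Real.sqrt_inv, ← Real.sqrt_mul (by positivity)]
  congr 1
  field_simp

theorem tendsto_coeff_position_pow (k : ℕ) (j : ℤ) :
    Tendsto (fun N : ℕ => ((((√(2 * N))⁻¹ • (ann + cre)) ^ k) (e N)) ((N : ℤ) + j).toNat)
      atTop (nhds (arcsineCoeff k j)) := by
  induction k generalizing j with
  | zero =>
    rw [arcsineCoeff_zero_left]
    refine tendsto_const_nhds.congr' ?_
    filter_upwards [eventually_ge_atTop j.natAbs] with N hN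
    have : N = ((N : ℤ) + j).toNat ↔ j = 0 := by omega
    simp [e, Finsupp.single_apply, this]
  | succ k ih =>
    rw [arcsineCoeff_succ]
    refine (((tendsto_inv_sqrt_mul_sqrt (j + 1)).mul (ih (j + 1))).add
      ((tendsto_inv_sqrt_mul_sqrt j).mul (ih (j - 1)))).congr' ?_
    filter_upwards [eventually_ge_atTop (j.natAbs + 1)] with N hN
    obtain ⟨n, hn⟩ : ∃ n : ℕ, (N : ℤ) + j = n + 1 := ⟨((N : ℤ) + j - 1).toNat, by omega⟩
    have hn' : (N : ℝ) + j = n + 1 := by exact_mod_cast hn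
    have h0 : ((N : ℤ) + j).toNat = n + 1 := by omega
    have h1 : ((N : ℤ) + (j + 1)).toNat = n + 1 + 1 := by omega
    have h2 : ((N : ℤ) + (j - 1)).toNat = n := by omega
    rw [h0, h1, h2, ← add_assoc, hn', pow_succ', Module.End.mul_apply, LinearMap.smul_apply,
      LinearMap.add_apply, Finsupp.smul_apply, Finsupp.add_apply, ann_apply, cre_apply_succ,
      smul_eq_mul]
    push_cast
    ring

theorem integrable_pow_of_even {ρ : Measure ℝ} [IsFiniteMeasure ρ] {k : ℕ}
    (h : Integrable (fun x : ℝ => x ^ (2 * k)) ρ) : Integrable (fun x : ℝ => x ^ k) ρ := by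
  refine ((integrable_const (1 : ℝ)).add h).mono' (by fun_prop) (Eventually.of_forall fun x => ?_)
  rw [Real.norm_eq_abs, Pi.add_apply, mul_comm, pow_mul, ← sq_abs]
  nlinarith [sq_nonneg (|x ^ k| - 1), abs_nonneg (x ^ k)]

/-- If `μ_N` is a probability measure whose moments are those of the rescaled
position `X/√N` in the `N`-th number state, then `μ_N` converges weakly to the
normalized arcsine law. -/
theorem weak_convergence_to_arcsine (μ : ℕ → Measure ℝ)
    (hprob : ∀ N, IsProbabilityMeasure (μ N))
    (hmom : ∀ k : ℕ, ∀ N : ℕ, 1 ≤ N →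
      ∫ x, x ^ k ∂(μ N) =
        innerF (e N) ((((Real.sqrt (2 * N))⁻¹ • (ann + cre)) ^ k) (e N))) :
    ∀ f : BoundedContinuousFunction ℝ ℝ,
      Tendsto (fun N => ∫ x, f x ∂(μ N)) atTop (nhds (∫ x, f x ∂arcsineLaw)) := by
  have hmom' (k : ℕ) : Tendsto (fun N => ∫ x, x ^ k ∂(μ N)) atTop
      (nhds (∫ x, x ^ k ∂arcsineLaw)) := by
    have h := tendsto_coeff_position_pow k 0
    rw [arcsineCoeff_zero_right] at h
    refine h.congr' ?_
    filter_upwards [eventually_ge_atTop 1] with N hN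
    rw [hmom k N hN, innerF_e, add_zero, Int.toNat_natCast]
  have hint (k : ℕ) : ∀ᶠ N in atTop, Integrable (fun x : ℝ => x ^ k) (μ N) := by
    filter_upwards [(hmom' (2 * k)).eventually_const_lt (integral_pow_even_arcsineLaw_pos k)]
      with N hN
    exact integrable_pow_of_even (not_imp_comm.1 integral_undef hN.ne')
  exact fun f => tendsto_integral_of_tendsto_moments (by positivity) ae_abs_le_arcsineLaw
    hint hmom' f
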